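/- (Buckley, strong type.) Let 1<p<∞ and let w ∈ A_p on ℝ^d. Then the Hardy–Littlewood maximal operator satisfies ‖Mf‖_{L^p(w)} ≤ C ‖w‖_{A_p}^{1/(p−1)} ‖f‖_{L^p(w)} for all f ∈ L^p(w), where C depends only on p and d. -/

import Mathlib

open MeasureTheory Set ENNReal

noncomputable section

/-- An axis-parallel cube in `ℝ^d` with corner `x` and side length `h`. -/
def cube (d : ℕ) (x : Fin d → ℝ) (h : ℝ) : Set (Fin d → ℝ) :=
  Set.univ.pi fun i => Set.Ico (x i) (x i + h)

/-- The average of (the nonnegative part of) `w` over a set `I`, valued in `ℝ≥0∞`. -/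
def lavg (d : ℕ) (w : (Fin d → ℝ) → ℝ) (I : Set (Fin d → ℝ)) : ℝ≥0∞ :=
  (volume I)⁻¹ * ∫⁻ y in I, ENNReal.ofReal (w y)

/-- The `A_p` characteristic of a weight `w` on `ℝ^d`:
the supremum over all cubes `I` of `(|I|⁻¹∫_I w)·(|I|⁻¹∫_I w^{-1/(p-1)})^{p-1}`. -/
def ApChar (d : ℕ) (p : ℝ) (w : (Fin d → ℝ) → ℝ) : ℝ≥0∞ :=
  ⨆ (x : Fin d → ℝ) (h : Set.Ioi (0:ℝ)),
    lavg d w (cube d x h) *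
      (lavg d (fun y => w y ^ (-1 / (p - 1))) (cube d x h)) ^ (p - 1)

/-- A weight on `ℝ^d`: a measurable, locally integrable, a.e. positive function. -/
def IsWeight (d : ℕ) (w : (Fin d → ℝ) → ℝ) : Prop :=
  Measurable w ∧ LocallyIntegrable w volume ∧ ∀ᵐ x : Fin d → ℝ, 0 < w x

/-- The Hardy–Littlewood maximal function
`Mf(x) := sup_{t>0} (2t)^{−d} ∫_{[−t,t]^d} |f(x−u)| du`, valued in `ℝ≥0∞`. -/
def maximalFn (d : ℕ) (f : (Fin d → ℝ) → ℝ) (x : Fin d → ℝ) : ℝ≥0∞ :=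
  ⨆ t : Set.Ioi (0:ℝ),
    (ENNReal.ofReal ((2 * (t:ℝ)) ^ d))⁻¹ *
      ∫⁻ u in Set.univ.pi fun _ : Fin d => Set.Icc (-(t:ℝ)) (t:ℝ), (‖f (x - u)‖₊ : ℝ≥0∞)

section CenteredMaximal

open Metric

variable {α : Type*} [MetricSpace α] [MeasurableSpace α]

/-- The centered maximal function with respect to `μ`, over closed balls of rational radius. -/
def centeredMaximal (μ : Measure α) (g : α → ℝ≥0∞) (x : α) : ℝ≥0∞ :=
  ⨆ q : {q : ℚ // 0 < q}, (μ (closedBall x (q : ℚ)))⁻¹ * ∫⁻ y in closedBall x (q : ℚ), g y ∂μ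

lemma average_le_centeredMaximal (μ : Measure α) (g : α → ℝ≥0∞) (x : α) {q : ℚ} (hq : 0 < q) :
    (μ (closedBall x q))⁻¹ * ∫⁻ y in closedBall x q, g y ∂μ ≤ centeredMaximal μ g x :=
  le_iSup (fun q : {q : ℚ // 0 < q} =>
    (μ (closedBall x (q : ℚ)))⁻¹ * ∫⁻ y in closedBall x (q : ℚ), g y ∂μ) ⟨q, hq⟩

lemma centeredMaximal_le_add_of_le (μ : Measure α) {g h : α → ℝ≥0∞} {c : ℝ≥0∞}
    (hgh : ∀ x, g x ≤ h x + c) (x : α) :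
    centeredMaximal μ g x ≤ centeredMaximal μ h x + c := by
  refine iSup_le fun q => ?_
  calc (μ (closedBall x (q : ℚ)))⁻¹ * ∫⁻ y in closedBall x (q : ℚ), g y ∂μ
      ≤ (μ (closedBall x (q : ℚ)))⁻¹ * ∫⁻ y in closedBall x (q : ℚ), (h y + c) ∂μ := by
        gcongr; exact hgh _
    _ = (μ (closedBall x (q : ℚ)))⁻¹ * ∫⁻ y in closedBall x (q : ℚ), h y ∂μ +
          c * ((μ (closedBall x (q : ℚ)))⁻¹ * μ (closedBall x (q : ℚ))) := by
        rw [lintegral_add_right _ measurable_const, setLIntegral_const]; ring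
    _ ≤ centeredMaximal μ h x + c * 1 := by
        gcongr
        · exact average_le_centeredMaximal μ h x q.2
        · exact ENNReal.inv_mul_le_one _
    _ = centeredMaximal μ h x + c := by rw [mul_one]

variable [BorelSpace α] [SecondCountableTopology α]

lemma measurable_setLIntegral_closedBall {μ : Measure α} [SFinite μ] {g : α → ℝ≥0∞}
    (hg : Measurable g) (r : ℝ) : Measurable fun x => ∫⁻ y in closedBall x r, g y ∂μ := by
  have h : Measurable fun x => ∫⁻ y, {z : α × α | dist z.2 z.1 ≤ r}.indicator
      (fun z => g z.2) (x, y) ∂μ := by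
    refine Measurable.lintegral_prod_right' (f := {z : α × α | dist z.2 z.1 ≤ r}.indicator
      (fun z => g z.2)) ?_
    exact (hg.comp measurable_snd).indicator
      (measurableSet_le (measurable_snd.dist measurable_fst) measurable_const)
  convert h using 2 with x
  rw [← lintegral_indicator measurableSet_closedBall]
  rfl

lemma measurable_centeredMaximal {μ : Measure α} [SFinite μ] {g : α → ℝ≥0∞}
    (hg : Measurable g) : Measurable (centeredMaximal μ g) := by
  refine Measurable.iSup fun q => ?_
  refine Measurable.mul (Measurable.inv ?_) (measurable_setLIntegral_closedBall hg _)
  simpa using measurable_setLIntegral_closedBall (μ := μ) (measurable_const (a := (1 : ℝ≥0∞))) q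

lemma mul_measure_le_of_bounded_radii {N : ℕ} {τ : ℝ} (hτ : 1 < τ)
    (hN : IsEmpty (Besicovitch.SatelliteConfig α N τ)) (μ : Measure α) (g : α → ℝ≥0∞) (c : ℝ≥0∞)
    (R : ℝ) :
    c * μ {x | ∃ r : ℝ, 0 < r ∧ r ≤ R ∧
      c < (μ (closedBall x r))⁻¹ * ∫⁻ y in closedBall x r, g y ∂μ} ≤ N * ∫⁻ y, g y ∂μ := by
  set S := {x | ∃ r : ℝ, 0 < r ∧ r ≤ R ∧
      c < (μ (closedBall x r))⁻¹ * ∫⁻ y in closedBall x r, g y ∂μ}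
  have hS : ∀ x : S, ∃ r : ℝ, 0 < r ∧ r ≤ R ∧
      c < (μ (closedBall (x : α) r))⁻¹ * ∫⁻ y in closedBall (x : α) r, g y ∂μ := fun x => x.2
  choose r hr0 hrR hr using hS
  let B : Besicovitch.BallPackage S α := ⟨fun x => x, r, hr0, R, hrR⟩
  obtain ⟨s, hs, hcov⟩ := Besicovitch.exist_disjoint_covering_families hτ hN B
  have hcount : ∀ i, (s i).Countable := fun i =>
    (hs i).countable_of_nonempty_interior fun j _ =>
      (nonempty_ball.2 (hr0 j)).mono ball_subset_interior_closedBall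
  have hfam : ∀ i, c * μ (⋃ j ∈ s i, closedBall (B.c j) (B.r j)) ≤ ∫⁻ y, g y ∂μ := fun i => by
    calc c * μ (⋃ j ∈ s i, closedBall (B.c j) (B.r j))
        ≤ c * ∑' j : s i, μ (closedBall (B.c j) (B.r j)) := by
          gcongr; exact measure_biUnion_le _ (hcount i) _
      _ = ∑' j : s i, c * μ (closedBall (B.c j) (B.r j)) := ENNReal.tsum_mul_left.symm
      _ ≤ ∑' j : s i, ∫⁻ y in closedBall (B.c j) (B.r j), g y ∂μ := by
          refine ENNReal.tsum_le_tsum fun j => ENNReal.mul_le_of_le_div ?_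
          rw [div_eq_mul_inv, mul_comm]
          exact (hr j).le
      _ = ∫⁻ y in ⋃ j ∈ s i, closedBall (B.c j) (B.r j), g y ∂μ :=
          (lintegral_biUnion (hcount i) (fun _ _ => measurableSet_closedBall) (hs i) _).symm
      _ ≤ ∫⁻ y, g y ∂μ := setLIntegral_le_lintegral _ _
  have hsub : S ⊆ ⋃ i, ⋃ j ∈ s i, closedBall (B.c j) (B.r j) := fun x hx => by
    have := hcov ⟨⟨x, hx⟩, rfl⟩
    simp only [mem_iUnion] at this ⊢
    obtain ⟨i, j, hj, h⟩ := this
    exact ⟨i, j, hj, ball_subset_closedBall h⟩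
  calc c * μ S ≤ c * ∑ i, μ (⋃ j ∈ s i, closedBall (B.c j) (B.r j)) := by
        gcongr
        exact (measure_mono hsub).trans (measure_iUnion_fintype_le _ _)
    _ = ∑ i, c * μ (⋃ j ∈ s i, closedBall (B.c j) (B.r j)) := Finset.mul_sum _ _ _
    _ ≤ ∑ _i : Fin N, ∫⁻ y, g y ∂μ := Finset.sum_le_sum fun i _ => hfam i
    _ = N * ∫⁻ y, g y ∂μ := by simp

/-- The weak type `(1,1)` bound for the centered maximal function, with a constant that does not
depend on the measure. -/
lemma mul_measure_centeredMaximal_le {N : ℕ} {τ : ℝ} (hτ : 1 < τ)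
    (hN : IsEmpty (Besicovitch.SatelliteConfig α N τ)) (μ : Measure α) (g : α → ℝ≥0∞) (c : ℝ≥0∞) :
    c * μ {x | c < centeredMaximal μ g x} ≤ N * ∫⁻ y, g y ∂μ := by
  let S : ℕ → Set α := fun n => {x | ∃ r : ℝ, 0 < r ∧ r ≤ n ∧
      c < (μ (closedBall x r))⁻¹ * ∫⁻ y in closedBall x r, g y ∂μ}
  have hmono : Monotone S := fun m n hmn x ⟨r, h0, hr, h⟩ =>
    ⟨r, h0, hr.trans (by exact_mod_cast hmn), h⟩
  have hsub : {x | c < centeredMaximal μ g x} ⊆ ⋃ n, S n := fun x hx => by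
    obtain ⟨q, hq⟩ := lt_iSup_iff.1 (show c < centeredMaximal μ g x from hx)
    obtain ⟨n, hn⟩ := exists_nat_ge ((q : ℚ) : ℝ)
    exact mem_iUnion.2 ⟨n, _, by exact_mod_cast q.2, hn, hq⟩
  calc c * μ {x | c < centeredMaximal μ g x} ≤ c * μ (⋃ n, S n) := by gcongr
    _ = ⨆ n, c * μ (S n) := by rw [hmono.measure_iUnion, ENNReal.mul_iSup]
    _ ≤ N * ∫⁻ y, g y ∂μ := iSup_le fun n => mul_measure_le_of_bounded_radii hτ hN μ g c n

lemma mul_measure_centeredMaximal_le_setLIntegral {N : ℕ} {τ : ℝ} (hτ : 1 < τ)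
    (hN : IsEmpty (Besicovitch.SatelliteConfig α N τ)) (μ : Measure α) {g : α → ℝ≥0∞}
    (hg : Measurable g) (c : ℝ≥0∞) :
    c * μ {x | 2 * c < centeredMaximal μ g x} ≤ N * ∫⁻ y in {y | c < g y}, g y ∂μ := by
  have hms : MeasurableSet {y | c < g y} := measurableSet_lt measurable_const hg
  rw [← lintegral_indicator hms]
  refine le_trans ?_ (mul_measure_centeredMaximal_le hτ hN μ _ c)
  refine mul_le_mul_right (measure_mono fun x hx => ?_) c
  have hle := centeredMaximal_le_add_of_le μ (g := g) (h := {y | c < g y}.indicator g) (c := c)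
    (fun y => by
      by_cases hy : c < g y
      · simp [indicator, hy]
      · simp [indicator, hy, not_lt.1 hy]) x
  have hlt : c + c < centeredMaximal μ ({y | c < g y}.indicator g) x + c := by
    rw [← two_mul]; exact lt_of_lt_of_le hx hle
  exact lt_of_add_lt_add_right hlt

end CenteredMaximal

section Strong

lemma lintegral_rpow_sub_one_of_lt {s : ℝ} (hs : 0 < s) (a : ℝ≥0∞) :
    ∫⁻ t in Ioi (0 : ℝ), {t : ℝ | ENNReal.ofReal t < a}.indicator
      (fun t => ENNReal.ofReal (t ^ (s - 1))) t = ENNReal.ofReal (1 / s) * a ^ s := by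
  have key : ∀ b : ℝ, 0 ≤ b → ∫⁻ t in Ioo 0 b, ENNReal.ofReal (t ^ (s - 1)) =
      ENNReal.ofReal (1 / s) * ENNReal.ofReal b ^ s := fun b hb => by
    have hi : IntervalIntegrable (fun t : ℝ => t ^ (s - 1)) volume 0 b :=
      intervalIntegral.intervalIntegrable_rpow' (by linarith)
    rw [setLIntegral_congr Ioo_ae_eq_Ioc, ← ofReal_integral_eq_lintegral_ofReal
      ((intervalIntegrable_iff_integrableOn_Ioc_of_le hb).1 hi)
      ((ae_restrict_iff' measurableSet_Ioc).2 (.of_forall fun t ht => Real.rpow_nonneg ht.1.le _)),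
      ← intervalIntegral.integral_of_le hb, integral_rpow (Or.inl (by linarith)),
      ENNReal.ofReal_rpow_of_nonneg hb hs.le, ← ENNReal.ofReal_mul (by positivity)]
    congr 1
    rw [sub_add_cancel, Real.zero_rpow hs.ne', sub_zero]
    ring
  have hset : ∀ b : ℝ, Ioi (0 : ℝ) ∩ {t : ℝ | ENNReal.ofReal t < ENNReal.ofReal b} = Ioo 0 b := by
    intro b
    ext t
    simp only [mem_inter_iff, mem_Ioi, mem_ofPred_eq, mem_Ioo, and_congr_right_iff]
    intro ht
    rw [ENNReal.ofReal_lt_ofReal_iff']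
    exact ⟨fun h => h.1, fun h => ⟨h, ht.trans h⟩⟩
  have hms : ∀ a : ℝ≥0∞, MeasurableSet {t : ℝ | ENNReal.ofReal t < a} := fun a =>
    measurableSet_lt ENNReal.measurable_ofReal measurable_const
  have hfin : ∀ b : ℝ, 0 ≤ b → ∫⁻ t in Ioi (0 : ℝ),
      {t : ℝ | ENNReal.ofReal t < ENNReal.ofReal b}.indicator
      (fun t => ENNReal.ofReal (t ^ (s - 1))) t =
        ENNReal.ofReal (1 / s) * ENNReal.ofReal b ^ s := fun b hb => by
    rw [setLIntegral_indicator (hms _), inter_comm, hset, key b hb]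
  rcases eq_or_ne a ∞ with rfl | ha
  · rw [ENNReal.top_rpow_of_pos hs, ENNReal.mul_top (by simpa using hs)]
    refine ENNReal.eq_top_of_forall_nnreal_le fun r => ?_
    have hb : (0 : ℝ) ≤ (s * r) ^ (1 / s) := by positivity
    have hr : ENNReal.ofReal (1 / s) * ENNReal.ofReal ((s * r) ^ (1 / s)) ^ s = r := by
      rw [ENNReal.ofReal_rpow_of_nonneg hb hs.le, ← Real.rpow_mul (by positivity),
        one_div_mul_cancel hs.ne', Real.rpow_one, ← ENNReal.ofReal_mul (by positivity),
        ← mul_assoc, one_div_mul_cancel hs.ne', one_mul, ENNReal.ofReal_coe_nnreal]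
    rw [← hr, ← hfin _ hb]
    exact lintegral_mono fun t => indicator_le_indicator_of_subset
      (fun u _ => ENNReal.ofReal_lt_top) (by simp) t
  · rw [← ENNReal.ofReal_toReal ha]
    exact hfin _ ENNReal.toReal_nonneg


/-- A form of the Marcinkiewicz interpolation theorem between weak `(1,1)` and `L^∞`. -/
lemma lintegral_rpow_le_of_weak_type {α : Type*} [MeasurableSpace α] {μ : Measure α} [SFinite μ]
    {F g : α → ℝ≥0∞} (hF : Measurable F) (hg : Measurable g) {K : ℝ≥0∞} {p : ℝ} (hp : 1 < p)
    (h : ∀ t : ℝ, 0 < t → ENNReal.ofReal t * μ {x | ENNReal.ofReal t < F x} ≤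
      K * ∫⁻ y in {y | ENNReal.ofReal t < g y}, g y ∂μ) :
    ENNReal.ofReal (1 / p) * ∫⁻ x, F x ^ p ∂μ ≤
      K * ENNReal.ofReal (1 / (p - 1)) * ∫⁻ x, g x ^ p ∂μ := by
  have hmeas : ∀ {G : α → ℝ≥0∞}, Measurable G → ∀ s : ℝ,
      Measurable fun z : ℝ × α => {t : ℝ | ENNReal.ofReal t < G z.2}.indicator
        (fun t => ENNReal.ofReal (t ^ (s - 1))) z.1 := fun {G} hG s => by
    have : Measurable ({z : ℝ × α | ENNReal.ofReal z.1 < G z.2}.indicator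
        (fun z => ENNReal.ofReal (z.1 ^ (s - 1)))) :=
      Measurable.indicator (by fun_prop) (measurableSet_lt (by fun_prop) (by fun_prop))
    exact this
  have hp1 : 0 < p - 1 := by linarith
  have hset : ∀ {G : α → ℝ≥0∞}, Measurable G → ∀ t : ℝ,
      MeasurableSet {x | ENNReal.ofReal t < G x} := fun hG t =>
    measurableSet_lt measurable_const hG
  calc ENNReal.ofReal (1 / p) * ∫⁻ x, F x ^ p ∂μ
      = ∫⁻ x, (∫⁻ t in Ioi (0 : ℝ), {t : ℝ | ENNReal.ofReal t < F x}.indicator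
          (fun t => ENNReal.ofReal (t ^ (p - 1))) t) ∂μ := by
        rw [← lintegral_const_mul _ (by fun_prop)]
        exact lintegral_congr fun x => (lintegral_rpow_sub_one_of_lt (by linarith) _).symm
    _ = ∫⁻ t in Ioi (0 : ℝ), ∫⁻ x, {t : ℝ | ENNReal.ofReal t < F x}.indicator
          (fun t => ENNReal.ofReal (t ^ (p - 1))) t ∂μ :=
        lintegral_lintegral_swap ((hmeas hF p).comp measurable_swap).aemeasurable
    _ = ∫⁻ t in Ioi (0 : ℝ), ENNReal.ofReal (t ^ (p - 1 - 1)) *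
          (ENNReal.ofReal t * μ {x | ENNReal.ofReal t < F x}) := by
        refine setLIntegral_congr_fun measurableSet_Ioi fun t ht => ?_
        have : ∀ x, {t : ℝ | ENNReal.ofReal t < F x}.indicator
            (fun t => ENNReal.ofReal (t ^ (p - 1))) t =
            {x | ENNReal.ofReal t < F x}.indicator
              (fun _ => ENNReal.ofReal (t ^ (p - 1))) x := fun x => rfl
        simp only [this]
        rw [lintegral_indicator_const (hset hF t), ← mul_assoc,
          ← ENNReal.ofReal_mul (Real.rpow_nonneg (le_of_lt ht) _), Real.rpow_sub_one (ne_of_gt ht) (p - 1),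
          div_mul_cancel₀ _ (ne_of_gt ht)]
    _ ≤ ∫⁻ t in Ioi (0 : ℝ), ENNReal.ofReal (t ^ (p - 1 - 1)) *
          (K * ∫⁻ y in {y | ENNReal.ofReal t < g y}, g y ∂μ) :=
        setLIntegral_mono' measurableSet_Ioi fun t ht => mul_le_mul_right (h t ht) _
    _ = ∫⁻ t in Ioi (0 : ℝ), ∫⁻ x, K * (g x * {t : ℝ | ENNReal.ofReal t < g x}.indicator
          (fun t => ENNReal.ofReal (t ^ (p - 1 - 1))) t) ∂μ := by
        refine lintegral_congr fun t => ?_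
        rw [← lintegral_indicator (hset hg t), ← lintegral_const_mul _ (hg.indicator (hset hg t)),
          ← lintegral_const_mul _ ((hg.indicator (hset hg t)).const_mul _)]
        refine lintegral_congr fun x => ?_
        by_cases hx : ENNReal.ofReal t < g x
        · simp only [indicator, mem_ofPred_eq, hx, if_true]; ring
        · simp [indicator, hx]
    _ = ∫⁻ x, (∫⁻ t in Ioi (0 : ℝ), K * (g x * {t : ℝ | ENNReal.ofReal t < g x}.indicator
          (fun t => ENNReal.ofReal (t ^ (p - 1 - 1))) t)) ∂μ :=
        lintegral_lintegral_swap
          (((hg.comp measurable_snd).mul (hmeas hg (p - 1))).const_mul K).aemeasurable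
    _ = ∫⁻ x, K * ENNReal.ofReal (1 / (p - 1)) * g x ^ p ∂μ := by
        refine lintegral_congr fun x => ?_
        have hm : Measurable fun t : ℝ => {t : ℝ | ENNReal.ofReal t < g x}.indicator
            (fun t => ENNReal.ofReal (t ^ (p - 1 - 1))) t :=
          (hmeas hg (p - 1)).comp measurable_prodMk_right
        have hgp : g x ^ p = g x * g x ^ (p - 1) := by
          conv_lhs => rw [← add_sub_cancel 1 p]
          rw [ENNReal.rpow_add_of_nonneg _ _ zero_le_one hp1.le, ENNReal.rpow_one]
        rw [lintegral_const_mul _ (hm.const_mul _), lintegral_const_mul _ hm,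
          lintegral_rpow_sub_one_of_lt hp1, hgp]
        ring
    _ = K * ENNReal.ofReal (1 / (p - 1)) * ∫⁻ x, g x ^ p ∂μ :=
        lintegral_const_mul _ (by fun_prop)

/-- The centered maximal function is bounded on `L^p(μ)`, uniformly in the measure `μ`. -/
theorem exists_lintegral_centeredMaximal_rpow_le (α : Type*) [MetricSpace α] [MeasurableSpace α]
    [BorelSpace α] [SecondCountableTopology α] [HasBesicovitchCovering α] {p : ℝ} (hp : 1 < p) :
    ∃ C : ℝ≥0∞, C ≠ ∞ ∧ ∀ (μ : Measure α) [SFinite μ] (g : α → ℝ≥0∞), Measurable g →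
      ∫⁻ x, centeredMaximal μ g x ^ p ∂μ ≤ C * ∫⁻ x, g x ^ p ∂μ := by
  obtain ⟨N, τ, hτ, hN⟩ := HasBesicovitchCovering.no_satelliteConfig (α := α)
  have hp0 : 0 < p := by linarith
  refine ⟨2 ^ p * (ENNReal.ofReal p * (N * ENNReal.ofReal (1 / (p - 1)))), ?_,
    fun μ _ g hg => ?_⟩
  · finiteness
  have hM : Measurable fun x => centeredMaximal μ g x / 2 :=
    (measurable_centeredMaximal hg).div_const 2
  have key := lintegral_rpow_le_of_weak_type (μ := μ) (K := N) hM hg hp fun t ht => by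
    convert mul_measure_centeredMaximal_le_setLIntegral hτ hN μ hg
      (ENNReal.ofReal t) using 5 with x
    rw [ENNReal.lt_div_iff_mul_lt (by simp) (by simp), mul_comm]
  calc ∫⁻ x, centeredMaximal μ g x ^ p ∂μ
      = 2 ^ p * (ENNReal.ofReal p * (ENNReal.ofReal (1 / p) *
          ∫⁻ x, (centeredMaximal μ g x / 2) ^ p ∂μ)) := by
        rw [← mul_assoc (ENNReal.ofReal p), ← ENNReal.ofReal_mul hp0.le, mul_one_div_cancel hp0.ne',
          ENNReal.ofReal_one, one_mul, ← lintegral_const_mul _ (hM.pow_const p)]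
        refine lintegral_congr fun x => ?_
        rw [← ENNReal.mul_rpow_of_nonneg _ _ hp0.le, ENNReal.mul_div_cancel (by simp) (by simp)]
    _ ≤ 2 ^ p * (ENNReal.ofReal p *
          (N * ENNReal.ofReal (1 / (p - 1)) * ∫⁻ x, g x ^ p ∂μ)) := by gcongr
    _ = _ := by ring

end Strong
section Buckley

open Metric

lemma setLIntegral_withDensity_mul_inv {α : Type*} [MeasurableSpace α] {μ : Measure α}
    {ω h : α → ℝ≥0∞} (hω : Measurable ω) (hω0 : ∀ᵐ x ∂μ, ω x ≠ 0) (hωt : ∀ᵐ x ∂μ, ω x ≠ ∞)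
    (hh : Measurable h) {s : Set α} (hs : MeasurableSet s) :
    ∫⁻ x in s, h x * (ω x)⁻¹ ∂μ.withDensity ω = ∫⁻ x in s, h x ∂μ := by
  rw [setLIntegral_withDensity_eq_setLIntegral_mul μ hω
    (g := fun x => h x * (ω x)⁻¹) (hh.mul hω.inv) hs]
  refine setLIntegral_congr_fun_ae hs ?_
  filter_upwards [hω0, hωt] with x h0 ht _
  rw [Pi.mul_apply, mul_left_comm, ENNReal.mul_inv_cancel h0 ht, mul_one]

lemma volume_cube (d : ℕ) (x : Fin d → ℝ) (h : ℝ) :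
    volume (cube d x h) = ENNReal.ofReal h ^ d := by
  simp [cube, Real.volume_pi_Ico]

lemma measurableSet_cube (d : ℕ) (x : Fin d → ℝ) (h : ℝ) : MeasurableSet (cube d x h) :=
  MeasurableSet.univ_pi fun _ => measurableSet_Ico

lemma volume_closedBall_pi (d : ℕ) (x : Fin d → ℝ) {t : ℝ} (ht : 0 ≤ t) :
    volume (closedBall x t) = ENNReal.ofReal ((2 * t) ^ d) := by
  rw [Real.volume_pi_closedBall x ht, Fintype.card_fin]

lemma closedBall_subset_cube (d : ℕ) (x : Fin d → ℝ) {r R : ℝ} (hr : 0 ≤ r) (h : r < R) :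
    closedBall x r ⊆ cube d (fun i => x i - R) (2 * R) := by
  intro y hy i _
  have := (dist_pi_le_iff hr).1 (mem_closedBall.1 hy) i
  rw [Real.dist_eq, abs_le] at this
  constructor <;> linarith

/-- The average of `F` over a ball is controlled by iterated centered maximal functions. -/
lemma average_rpow_le_centeredMaximal {d : ℕ} {p : ℝ} (hp : 1 < p) {ω σ : (Fin d → ℝ) → ℝ≥0∞}
    (hω : Measurable ω) (hσ : Measurable σ)
    (hω0 : ∀ᵐ x, ω x ≠ 0) (hωt : ∀ᵐ x, ω x ≠ ∞) (hσ0 : ∀ᵐ x, σ x ≠ 0) (hσt : ∀ᵐ x, σ x ≠ ∞)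
    (hfin : ∀ x r, volume.withDensity ω (closedBall x r) ≠ ∞) {A : ℝ≥0∞} (hA : A ≠ ∞)
    (hap : ∀ (x : Fin d → ℝ) (h : ℝ), 0 < h → volume.withDensity ω (cube d x h) *
      volume.withDensity σ (cube d x h) ^ (p - 1) ≤ A * volume (cube d x h) ^ p)
    {F : (Fin d → ℝ) → ℝ≥0∞} (hF : Measurable F) (x : Fin d → ℝ) {t : ℝ} (ht : 0 < t) :
    ((volume (closedBall x t))⁻¹ * ∫⁻ y in closedBall x t, F y) ^ (p - 1) ≤
      (4 ^ d : ℝ≥0∞) ^ p * A * centeredMaximal (volume.withDensity ω) (fun y =>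
        centeredMaximal (volume.withDensity σ) (fun z => F z * (σ z)⁻¹) y ^ (p - 1) * (ω y)⁻¹)
          x := by
  have hp1 : 0 < p - 1 := by linarith
  set W := volume.withDensity ω with hW
  set S := volume.withDensity σ with hS
  set N := centeredMaximal S (fun z => F z * (σ z)⁻¹) with hN
  set M := centeredMaximal W (fun y => N y ^ (p - 1) * (ω y)⁻¹) x with hM
  obtain ⟨q, hq2, hq3⟩ := exists_rat_btwn (show 2 * t < 3 * t by linarith)
  have hq0 : 0 < q := by
    have : (0 : ℝ) < q := by linarith
    exact_mod_cast this
  set B := closedBall x t with hB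
  set K := cube d (fun i => x i - 4 * t) (2 * (4 * t)) with hK
  set v := volume B with hv
  have hvB : v = ENNReal.ofReal ((2 * t) ^ d) := volume_closedBall_pi d x ht.le
  have hv0 : v ≠ 0 := by rw [hvB]; simp; positivity
  have hvt : v ≠ ∞ := by rw [hvB]; exact ENNReal.ofReal_ne_top
  have hKv : volume K = 4 ^ d * v := by
    rw [hK, volume_cube, hvB, ENNReal.ofReal_pow (by positivity), ← mul_pow]
    congr 1
    rw [show (4 : ℝ≥0∞) = ENNReal.ofReal 4 by simp, ← ENNReal.ofReal_mul (by norm_num)]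
    congr 1; ring
  have hBK : ∀ y ∈ B, closedBall y q ⊆ K := fun y hy =>
    (closedBall_subset_closedBall' (by linarith [mem_closedBall.1 hy])).trans
      (closedBall_subset_cube d x (r := q + t) (by linarith) (by linarith))
  have hBy : ∀ y ∈ B, B ⊆ closedBall y q := fun y hy =>
    closedBall_subset_closedBall' (by linarith [mem_closedBall'.1 hy])
  have hxB : x ∈ B := mem_closedBall_self ht.le
  have hWq0 : W (closedBall x q) ≠ 0 := fun h0 => hv0 <|
    measure_mono_null (hBy x hxB) (withDensity_absolutelyContinuous' hω.aemeasurable hω0 h0)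
  have hSK0 : S K ≠ 0 := fun h0 => hv0 <| measure_mono_null ((hBy x hxB).trans (hBK x hxB))
    (withDensity_absolutelyContinuous' hσ.aemeasurable hσ0 h0)
  have hapK := hap (fun i => x i - 4 * t) (2 * (4 * t)) (by positivity)
  rw [← hK, hKv] at hapK
  have hSKt : S K ≠ ∞ := by
    intro htop
    rw [htop, ENNReal.top_rpow_of_pos hp1, ENNReal.mul_top] at hapK
    · exact absurd hapK (not_le.2 (by finiteness [hp.trans' zero_lt_one]))
    · exact fun h0 => hWq0 (measure_mono_null (hBK x hxB) h0)
  have hNle : ∀ y ∈ B, (S K)⁻¹ * ∫⁻ z in B, F z ≤ N y := fun y hy => by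
    calc (S K)⁻¹ * ∫⁻ z in B, F z
        ≤ (S (closedBall y q))⁻¹ * ∫⁻ z in closedBall y q, F z := by
          gcongr
          · exact hBK y hy
          · exact hBy y hy
      _ = (S (closedBall y q))⁻¹ * ∫⁻ z in closedBall y q, F z * (σ z)⁻¹ ∂S := by
          rw [hS, setLIntegral_withDensity_mul_inv hσ hσ0 hσt hF measurableSet_closedBall]
      _ ≤ N y := average_le_centeredMaximal S _ y hq0
  have hNm : Measurable N := measurable_centeredMaximal (hF.mul hσ.inv)
  have hint : v * ((S K)⁻¹ * ∫⁻ z in B, F z) ^ (p - 1) ≤ W K * M := by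
    calc v * ((S K)⁻¹ * ∫⁻ z in B, F z) ^ (p - 1)
        = ∫⁻ _y in B, ((S K)⁻¹ * ∫⁻ z in B, F z) ^ (p - 1) := by
          rw [setLIntegral_const, mul_comm]
      _ ≤ ∫⁻ y in B, N y ^ (p - 1) :=
          setLIntegral_mono' measurableSet_closedBall fun y hy =>
            ENNReal.rpow_le_rpow (hNle y hy) hp1.le
      _ = ∫⁻ y in B, N y ^ (p - 1) * (ω y)⁻¹ ∂W := by
          rw [hW, setLIntegral_withDensity_mul_inv hω hω0 hωt (hNm.pow_const _)
            measurableSet_closedBall]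
      _ ≤ ∫⁻ y in closedBall x q, N y ^ (p - 1) * (ω y)⁻¹ ∂W :=
          lintegral_mono_set (hBy x hxB)
      _ ≤ W (closedBall x q) * M :=
          (ENNReal.inv_mul_le_iff hWq0 (hfin x q)).1 (average_le_centeredMaximal W _ x hq0)
      _ ≤ W K * M := by gcongr; exact hBK x hxB
  have hpow : (v⁻¹ : ℝ≥0∞) ^ (p - 1) = v⁻¹ ^ p * v := by
    rw [ENNReal.rpow_sub _ _ (by simpa using hvt) (by simpa using hv0), ENNReal.rpow_one,
      div_eq_mul_inv, inv_inv]
  calc (v⁻¹ * ∫⁻ y in B, F y) ^ (p - 1)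
      = (v⁻¹ * (S K * ((S K)⁻¹ * ∫⁻ y in B, F y))) ^ (p - 1) := by
        rw [← mul_assoc (S K), ENNReal.mul_inv_cancel hSK0 hSKt, one_mul]
    _ = v⁻¹ ^ p * S K ^ (p - 1) * (v * ((S K)⁻¹ * ∫⁻ z in B, F z) ^ (p - 1)) := by
        rw [ENNReal.mul_rpow_of_nonneg _ _ hp1.le, ENNReal.mul_rpow_of_nonneg _ _ hp1.le, hpow]
        ring
    _ ≤ v⁻¹ ^ p * S K ^ (p - 1) * (W K * M) := by gcongr
    _ = v⁻¹ ^ p * (W K * S K ^ (p - 1)) * M := by ring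
    _ ≤ v⁻¹ ^ p * (A * (4 ^ d * v) ^ p) * M := by gcongr
    _ = (v⁻¹ * v) ^ p * ((4 ^ d : ℝ≥0∞) ^ p * A * M) := by
        rw [ENNReal.mul_rpow_of_nonneg _ _ (by linarith), ENNReal.mul_rpow_of_nonneg _ _
          (by linarith)]
        ring
    _ = (4 ^ d : ℝ≥0∞) ^ p * A * M := by
        rw [ENNReal.inv_mul_cancel hv0 hvt, ENNReal.one_rpow, one_mul]

lemma maximalFn_eq_iSup_closedBall (d : ℕ) (f : (Fin d → ℝ) → ℝ) (x : Fin d → ℝ) :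
    maximalFn d f x = ⨆ t : Ioi (0 : ℝ),
      (volume (closedBall x (t : ℝ)))⁻¹ * ∫⁻ y in closedBall x (t : ℝ), (‖f y‖₊ : ℝ≥0∞) := by
  refine iSup_congr fun ⟨t, ht⟩ => ?_
  have ht : 0 < t := ht
  rw [volume_closedBall_pi d x ht.le]
  congr 1
  rw [← lintegral_indicator measurableSet_closedBall,
    ← lintegral_indicator (MeasurableSet.univ_pi fun _ => measurableSet_Icc),
    ← lintegral_sub_left_eq_self ((closedBall x t).indicator fun y => (‖f y‖₊ : ℝ≥0∞)) x]
  refine lintegral_congr fun u => ?_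
  have : (u ∈ univ.pi fun _ : Fin d => Icc (-t) t) ↔ x - u ∈ closedBall x t := by
    rw [mem_closedBall, dist_pi_le_iff ht.le]
    simp only [mem_pi, mem_univ, true_imp_iff, mem_Icc, Pi.sub_apply, Real.dist_eq,
      sub_sub_cancel_left, abs_neg, abs_le]
  by_cases h : x - u ∈ closedBall x t
  · rw [indicator_of_mem h, indicator_of_mem (this.2 h)]
  · rw [indicator_of_notMem h, indicator_of_notMem (fun h' => h (this.1 h'))]

lemma withDensity_mul_rpow_le_ApChar {d : ℕ} {p : ℝ} (hp : 1 < p) (w : (Fin d → ℝ) → ℝ)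
    (x : Fin d → ℝ) {h : ℝ} (hh : 0 < h) :
    volume.withDensity (fun y => ENNReal.ofReal (w y)) (cube d x h) *
      volume.withDensity (fun y => ENNReal.ofReal (w y ^ (-1 / (p - 1)))) (cube d x h) ^ (p - 1) ≤
        ApChar d p w * volume (cube d x h) ^ p := by
  have hp1 : 0 < p - 1 := by linarith
  set W := volume.withDensity (fun y => ENNReal.ofReal (w y)) (cube d x h) with hW
  set S := volume.withDensity (fun y => ENNReal.ofReal (w y ^ (-1 / (p - 1)))) (cube d x h) with hS
  set V := volume (cube d x h) with hV
  have hV0 : V ≠ 0 := by rw [hV, volume_cube]; simp [hh]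
  have hVt : V ≠ ∞ := by rw [hV, volume_cube]; finiteness
  have hle : V⁻¹ * W * (V⁻¹ * S) ^ (p - 1) ≤ ApChar d p w := by
    refine le_trans (le_of_eq ?_) (le_iSup₂ (f := fun (x : Fin d → ℝ) (h : Ioi (0 : ℝ)) =>
      lavg d w (cube d x h) * (lavg d (fun y => w y ^ (-1 / (p - 1))) (cube d x h)) ^ (p - 1))
      x ⟨h, hh⟩)
    simp only [lavg]
    rw [hW, hS, withDensity_apply _ (measurableSet_cube d x h),
      withDensity_apply _ (measurableSet_cube d x h)]
  have hpow : V ^ p = V ^ (p - 1) * V := by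
    rw [ENNReal.rpow_sub _ _ hV0 hVt, ENNReal.rpow_one, ENNReal.div_mul_cancel hV0 hVt]
  calc W * S ^ (p - 1) = (V * V⁻¹) * W * ((V * V⁻¹) * S) ^ (p - 1) := by
        rw [ENNReal.mul_inv_cancel hV0 hVt, one_mul, one_mul]
    _ = V⁻¹ * W * (V⁻¹ * S) ^ (p - 1) * V ^ p := by
        rw [mul_assoc V V⁻¹ S, ENNReal.mul_rpow_of_nonneg _ _ hp1.le, hpow]
        ring
    _ ≤ ApChar d p w * V ^ p := by gcongr

/-- **Buckley's bound in integrated form.** -/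
lemma lintegral_maximalFn_rpow_le {d : ℕ} {p : ℝ} (hp : 1 < p) {C₁ C₂ : ℝ≥0∞}
    (hC₁ : ∀ (μ : Measure (Fin d → ℝ)) [SFinite μ] (g : (Fin d → ℝ) → ℝ≥0∞), Measurable g →
      ∫⁻ x, centeredMaximal μ g x ^ (p / (p - 1)) ∂μ ≤ C₁ * ∫⁻ x, g x ^ (p / (p - 1)) ∂μ)
    (hC₂ : ∀ (μ : Measure (Fin d → ℝ)) [SFinite μ] (g : (Fin d → ℝ) → ℝ≥0∞), Measurable g →
      ∫⁻ x, centeredMaximal μ g x ^ p ∂μ ≤ C₂ * ∫⁻ x, g x ^ p ∂μ)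
    {w : (Fin d → ℝ) → ℝ} (hw : IsWeight d w) (hA : ApChar d p w < ⊤)
    {f : (Fin d → ℝ) → ℝ} (hf : Measurable f) :
    ∫⁻ x, maximalFn d f x ^ p * ENNReal.ofReal (w x) ≤
      ((4 ^ d : ℝ≥0∞) ^ p * ApChar d p w) ^ (p / (p - 1)) * (C₁ * (C₂ *
        ∫⁻ x, (‖f x‖₊ : ℝ≥0∞) ^ p * ENNReal.ofReal (w x))) := by
  obtain ⟨hwm, hwi, hw0⟩ := hw
  have hp0 : 0 < p := by linarith
  have hp1 : 0 < p - 1 := by linarith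
  set p' := p / (p - 1) with hp'
  have hp'0 : 0 < p' := by positivity
  set ω : (Fin d → ℝ) → ℝ≥0∞ := fun y => ENNReal.ofReal (w y) with hωdef
  set σ : (Fin d → ℝ) → ℝ≥0∞ := fun y => ENNReal.ofReal (w y ^ (-1 / (p - 1))) with hσdef
  set F : (Fin d → ℝ) → ℝ≥0∞ := fun y => (‖f y‖₊ : ℝ≥0∞) with hFdef
  have hω : Measurable ω := by fun_prop
  have hσ : Measurable σ := by fun_prop
  have hF : Measurable F := by fun_prop
  have hω0 : ∀ᵐ x, ω x ≠ 0 := hw0.mono fun x hx => by simpa [hωdef] using hx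
  have hσ0 : ∀ᵐ x, σ x ≠ 0 := hw0.mono fun x hx => by
    simpa [hσdef] using Real.rpow_pos_of_pos hx _
  have hωt : ∀ x, ω x ≠ ∞ := fun x => ENNReal.ofReal_ne_top
  have hσt : ∀ x, σ x ≠ ∞ := fun x => ENNReal.ofReal_ne_top
  have hσω : ∀ᵐ x, σ x = ω x ^ (-1 / (p - 1)) := hw0.mono fun x hx =>
    (ENNReal.ofReal_rpow_of_pos hx).symm
  have hfin : ∀ x r, volume.withDensity ω (closedBall x r) ≠ ∞ := fun x r => by
    rw [withDensity_apply _ measurableSet_closedBall]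
    exact (hwi.integrableOn_isCompact (isCompact_closedBall x r)).lintegral_lt_top.ne
  set N := centeredMaximal (volume.withDensity σ) (fun z => F z * (σ z)⁻¹) with hN
  set g : (Fin d → ℝ) → ℝ≥0∞ := fun y => N y ^ (p - 1) * (ω y)⁻¹ with hg
  have hNm : Measurable N := measurable_centeredMaximal (hF.mul hσ.inv)
  have hgm : Measurable g := (hNm.pow_const _).mul hω.inv
  set c := (4 ^ d : ℝ≥0∞) ^ p * ApChar d p w with hc
  have hmax : ∀ x, maximalFn d f x ^ p ≤ c ^ p' *
      centeredMaximal (volume.withDensity ω) g x ^ p' := fun x => by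
    have h1 : maximalFn d f x ≤ (c * centeredMaximal (volume.withDensity ω) g x) ^ (p - 1)⁻¹ := by
      rw [maximalFn_eq_iSup_closedBall]
      refine iSup_le fun t => ?_
      rw [ENNReal.le_rpow_inv_iff hp1]
      exact average_rpow_le_centeredMaximal hp hω hσ hω0 (.of_forall hωt) hσ0 (.of_forall hσt)
        hfin hA.ne (fun x h hh => withDensity_mul_rpow_le_ApChar hp w x hh) hF x t.2
    refine (ENNReal.rpow_le_rpow h1 hp0.le).trans (le_of_eq ?_)
    rw [← ENNReal.rpow_mul, ← ENNReal.mul_rpow_of_nonneg _ _ hp'0.le, inv_mul_eq_div]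
  have hgp : ∫⁻ x, ω x * g x ^ p' = ∫⁻ x, σ x * N x ^ p := by
    refine lintegral_congr_ae ?_
    filter_upwards [hω0, hσω] with x h0 hσx
    have e1 : (p - 1) * p' = p := by rw [hp']; field_simp
    have e2 : -1 / (p - 1) = 1 + -p' := by rw [hp']; field_simp; ring
    rw [hσx, e2, ENNReal.rpow_add _ _ h0 (hωt x), ENNReal.rpow_one, hg,
      ENNReal.mul_rpow_of_nonneg _ _ hp'0.le, ← ENNReal.rpow_mul, e1, ENNReal.rpow_neg,
      ENNReal.inv_rpow]
    ring
  have hFp : ∫⁻ x, σ x * (F x * (σ x)⁻¹) ^ p = ∫⁻ x, F x ^ p * ω x := by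
    refine lintegral_congr_ae ?_
    filter_upwards [hω0, hσ0, hσω] with x h0 hσxne hσx
    have e1 : ω x = σ x ^ (1 + -p) := by
      rw [hσx, ← ENNReal.rpow_mul, show -1 / (p - 1) * (1 + -p) = 1 by field_simp; ring,
        ENNReal.rpow_one]
    rw [e1, ENNReal.rpow_add _ _ hσxne (hσt x), ENNReal.rpow_one,
      ENNReal.mul_rpow_of_nonneg _ _ hp0.le, ENNReal.rpow_neg, ENNReal.inv_rpow]
    ring
  have hMm : Measurable (centeredMaximal (volume.withDensity ω) g) := measurable_centeredMaximal hgm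
  calc ∫⁻ x, maximalFn d f x ^ p * ω x
      ≤ ∫⁻ x, c ^ p' * (ω x * centeredMaximal (volume.withDensity ω) g x ^ p') := by
        refine lintegral_mono fun x => (mul_le_mul_left (hmax x) (ω x)).trans (le_of_eq ?_)
        ring
    _ = c ^ p' * ∫⁻ x, centeredMaximal (volume.withDensity ω) g x ^ p' ∂volume.withDensity ω := by
        rw [lintegral_const_mul _ (by fun_prop),
          lintegral_withDensity_eq_lintegral_mul _ hω (hMm.pow_const _)]
        rfl
    _ ≤ c ^ p' * (C₁ * ∫⁻ x, g x ^ p' ∂volume.withDensity ω) := by gcongr; exact hC₁ _ _ hgm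
    _ = c ^ p' * (C₁ * ∫⁻ x, N x ^ p ∂volume.withDensity σ) := by
        rw [lintegral_withDensity_eq_lintegral_mul _ hω (hgm.pow_const _),
          lintegral_withDensity_eq_lintegral_mul _ hσ (hNm.pow_const _)]
        simp only [Pi.mul_apply]
        rw [hgp]
    _ ≤ c ^ p' * (C₁ * (C₂ * ∫⁻ x, (F x * (σ x)⁻¹) ^ p ∂volume.withDensity σ)) := by
        gcongr; exact hC₂ _ _ (hF.mul hσ.inv)
    _ = c ^ p' * (C₁ * (C₂ * ∫⁻ x, F x ^ p * ω x)) := by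
        rw [lintegral_withDensity_eq_lintegral_mul _ hσ (g := fun x => (F x * (σ x)⁻¹) ^ p)
          ((hF.mul hσ.inv).pow_const _)]
        simp only [Pi.mul_apply]
        rw [hFp]

end Buckley

/-- **Buckley's strong-type bound.** For `1 < p < ∞` there is a constant `C = C(p,d)` such that
for every `w ∈ A_p` on `ℝ^d` and all `f ∈ L^p(w)`,
`‖Mf‖_{L^p(w)} ≤ C ‖w‖_{A_p}^{1/(p−1)} ‖f‖_{L^p(w)}`. -/
theorem buckley_strong_type (d : ℕ) (p : ℝ) (hp : 1 < p) :
    ∃ C : ℝ, 0 < C ∧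
      ∀ w : (Fin d → ℝ) → ℝ, IsWeight d w → ApChar d p w < ⊤ →
        ∀ f : (Fin d → ℝ) → ℝ, Measurable f →
          (∫⁻ x, (maximalFn d f x) ^ p * ENNReal.ofReal (w x)) ^ (1 / p) ≤
            ENNReal.ofReal C * (ApChar d p w) ^ (1 / (p - 1)) *
              (∫⁻ x, (‖f x‖₊ : ℝ≥0∞) ^ p * ENNReal.ofReal (w x)) ^ (1 / p) := by
  have hp0 : 0 < p := by linarith
  have hp1 : 0 < p - 1 := by linarith
  have hp' : 1 < p / (p - 1) := by rw [lt_div_iff₀ hp1]; linarith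
  obtain ⟨C₁, hC₁t, hC₁⟩ := exists_lintegral_centeredMaximal_rpow_le (Fin d → ℝ) hp'
  obtain ⟨C₂, hC₂t, hC₂⟩ := exists_lintegral_centeredMaximal_rpow_le (Fin d → ℝ) hp
  set D : ℝ≥0∞ := ((4 ^ d : ℝ≥0∞) ^ p) ^ (1 / (p - 1)) * (C₁ * C₂) ^ (1 / p) with hD
  have hDt : D ≠ ∞ := by
    have h1 : 0 ≤ 1 / (p - 1) := by positivity
    have h2 : 0 ≤ 1 / p := by positivity
    rw [hD]
    finiteness
  refine ⟨D.toReal + 1, by positivity, fun w hw hA f hf => ?_⟩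
  have hDle : D ≤ ENNReal.ofReal (D.toReal + 1) := by
    rw [ENNReal.le_ofReal_iff_toReal_le hDt (by positivity)]
    linarith
  have hexp : p / (p - 1) * (1 / p) = 1 / (p - 1) := by field_simp
  refine (ENNReal.rpow_le_rpow (lintegral_maximalFn_rpow_le hp hC₁ hC₂ hw hA hf)
    (by positivity)).trans ?_
  rw [← mul_assoc C₁, ENNReal.mul_rpow_of_nonneg _ _ (by positivity), ← ENNReal.rpow_mul, hexp,
    ENNReal.mul_rpow_of_nonneg _ _ (by positivity), ENNReal.mul_rpow_of_nonneg _ _ (by positivity)]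
  calc _ = D * ApChar d p w ^ (1 / (p - 1)) *
        (∫⁻ x, (‖f x‖₊ : ℝ≥0∞) ^ p * ENNReal.ofReal (w x)) ^ (1 / p) := by rw [hD]; ring
    _ ≤ _ := by gcongr
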